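/- Suppose Assumption (H) holds and fix r > 0. For every S ≥ 0 there exist constants G₂ ≥ G₁ > 0 (depending only on S, r and ρ*) such that for every a, b ∈ ℝ with a < b, every positive continuous function ρ on [a,b] belonging to H¹(a,b), and every continuous function v on [a,b], with ∫_a^b ρ(x)dx = 1 and V(a,b,ρ,v) ≤ S, one has G₁·Ξ ≤ V(a,b,ρ,v) ≤ G₂·Ξ, where Ξ := (b−a)∫_a^b ρ_x²(x)dx + (max_{a≤x≤b}|ρ(x) − ρ*|)² + v²(a) + v²(b) + (b−a)^{-1}∫_a^b v²(x)dx. -/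

import Mathlib

open MeasureTheory Set Filter

/-- `Q(ρ) = ρ ∫_{ρ*}^{ρ} P(τ)/τ² dτ − (P(ρ*)/ρ*)ρ + P(ρ*)`. -/
noncomputable def Qf (P : ℝ → ℝ) (ρs x : ℝ) : ℝ :=
  x * (∫ τ in ρs..x, P τ / τ ^ 2) - (P ρs / ρs) * x + P ρs

/-- `k(ρ) = ∫_{ρ*}^{ρ} μ(τ)/τ dτ`. -/
noncomputable def kf (μ : ℝ → ℝ) (ρs x : ℝ) : ℝ :=
  ∫ τ in ρs..x, μ τ / τ

/-- `G(ρ) = ∫_{ρ*}^{ρ} μ(l) l^{-3/2} √(Q(l)) dl`. -/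
noncomputable def Gf (P μ : ℝ → ℝ) (ρs x : ℝ) : ℝ :=
  ∫ l in ρs..x, μ l / l ^ ((3 : ℝ) / 2) * Real.sqrt (Qf P ρs l)

/-- Assumption (H): `G(ρ) → +∞` as `ρ → +∞`, `G(ρ) → −∞` as `ρ → 0⁺`,
and `k(ρ) → +∞` as `ρ → +∞`. -/
def AssumpH (P μ : ℝ → ℝ) (ρs : ℝ) : Prop :=
  Tendsto (Gf P μ ρs) atTop atTop ∧
  Tendsto (Gf P μ ρs) (nhdsWithin 0 (Ioi 0)) atBot ∧
  Tendsto (kf μ ρs) atTop atTop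

/-- Potential energy `U(a,b,ρ) = ∫_a^b Q(ρ(x)) dx`. -/
noncomputable def Uf (P : ℝ → ℝ) (ρs a b : ℝ) (ρ : ℝ → ℝ) : ℝ :=
  ∫ x in a..b, Qf P ρs (ρ x)

/-- Total mechanical energy `E`. -/
noncomputable def Ef (P : ℝ → ℝ) (ρs a b : ℝ) (ρ v : ℝ → ℝ) : ℝ :=
  (v a) ^ 2 / 2 + (v b) ^ 2 / 2 + (1 / 2) * (∫ x in a..b, ρ x * (v x) ^ 2)
    + Uf P ρs a b ρ

/-- Transformed energy `W`. -/
noncomputable def Wf (P μ : ℝ → ℝ) (ρs a b : ℝ) (ρ ρx v : ℝ → ℝ) : ℝ :=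
  (1 / 2) * (∫ x in a..b, (ρ x)⁻¹ * (ρ x * v x + μ (ρ x) * (ρ x)⁻¹ * ρx x) ^ 2)
    + (1 / 2) * (v b - kf μ ρs (ρ b)) ^ 2
    + (1 / 2) * (v a + kf μ ρs (ρ a)) ^ 2
    + Uf P ρs a b ρ

/-- Control Lyapunov functional `V = W + r E`. -/
noncomputable def Vf (P μ : ℝ → ℝ) (ρs r a b : ℝ) (ρ ρx v : ℝ → ℝ) : ℝ :=
  Wf P μ ρs a b ρ ρx v + r * Ef P ρs a b ρ v

/-- `f ∈ H¹(a,b)` with weak derivative `f'`:  `f' ∈ L¹ ∩ L²(a,b)` and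
`f(x) = f(a) + ∫_a^x f'(s) ds` on `[a,b]`. -/
def H1On (a b : ℝ) (f f' : ℝ → ℝ) : Prop :=
  IntervalIntegrable f' volume a b ∧
  IntervalIntegrable (fun s => (f' s) ^ 2) volume a b ∧
  ∀ x ∈ Icc a b, f x = f a + ∫ s in a..x, f' s


lemma lip_of_deriv {F g : ℝ → ℝ} (hF : ∀ y, 0 < y → HasDerivAt F (g y) y)
    (hg : ContinuousOn g (Ioi 0)) {m M : ℝ} (hm : 0 < m) :
    ∃ C : ℝ, 0 < C ∧ ∀ x ∈ Icc m M, ∀ y ∈ Icc m M, |F x - F y| ≤ C * |x - y| := by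
  have hsub : Icc m M ⊆ Ioi 0 := fun x hx => lt_of_lt_of_le hm hx.1
  obtain ⟨C, hC⟩ := isCompact_Icc.exists_bound_of_continuousOn (hg.mono hsub)
  refine ⟨|C| + 1, by positivity, fun x hx y hy => ?_⟩
  have := (convex_Icc m M).norm_image_sub_le_of_norm_hasDerivWithin_le
    (f := F) (f' := g) (C := |C| + 1)
    (fun z hz => (hF z (hsub hz)).hasDerivWithinAt)
    (fun z hz => (hC z hz).trans (by linarith [le_abs_self C])) hy hx
  simpa [Real.norm_eq_abs] using this

lemma ac_comp {F ρ : ℝ → ℝ} {a b C : ℝ} (hab : a ≤ b) {s : Set ℝ} (hC : 0 < C)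
    (hF : ∀ x ∈ s, ∀ y ∈ s, |F x - F y| ≤ C * |x - y|)
    (hs : ∀ x ∈ Icc a b, ρ x ∈ s)
    (hρ : AbsolutelyContinuousOnInterval ρ a b) :
    AbsolutelyContinuousOnInterval (fun x => F (ρ x)) a b := by
  rw [absolutelyContinuousOnInterval_iff] at hρ ⊢
  intro ε hε
  obtain ⟨δ, hδ, h⟩ := hρ (ε / C) (by positivity)
  refine ⟨δ, hδ, fun E hE hl => ?_⟩
  have h1 := h E hE hl
  have h2 : ∑ i ∈ Finset.range E.1, dist (F (ρ (E.2 i).1)) (F (ρ (E.2 i).2)) ≤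
      ∑ i ∈ Finset.range E.1, C * dist (ρ (E.2 i).1) (ρ (E.2 i).2) := by
    apply Finset.sum_le_sum
    intro i hi
    have := hE.1 i hi
    rw [uIcc_of_le hab] at this
    exact hF _ (hs _ this.1) _ (hs _ this.2)
  rw [← Finset.mul_sum] at h2
  calc _ ≤ _ := h2
    _ < C * (ε / C) := by gcongr
    _ = ε := by field_simp

lemma chain_rule {F g ρ ρx : ℝ → ℝ} {a b : ℝ} (hab : a < b)
    (hF : ∀ y, 0 < y → HasDerivAt F (g y) y) (hg : ContinuousOn g (Ioi 0))
    (hρc : ContinuousOn ρ (Icc a b)) (hpos : ∀ x ∈ Icc a b, 0 < ρ x)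
    (hH : H1On a b ρ ρx) {x y : ℝ} (hx : x ∈ Icc a b) (hy : y ∈ Icc a b) :
    F (ρ y) - F (ρ x) = ∫ s in x..y, g (ρ s) * ρx s := by
  obtain ⟨h1, -, h3⟩ := hH
  have hac0 := h1.absolutelyContinuousOnInterval_intervalIntegral (c := a) left_mem_uIcc
  obtain ⟨xm, hxm, hmin⟩ := isCompact_Icc.exists_isMinOn (nonempty_Icc.2 hab.le) hρc
  obtain ⟨xM, hxM, hmax⟩ := isCompact_Icc.exists_isMaxOn (nonempty_Icc.2 hab.le) hρc
  obtain ⟨C, hC, hlip⟩ := lip_of_deriv hF hg (m := ρ xm) (M := ρ xM) (hpos _ hxm)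
  have hmem : ∀ z ∈ Icc a b, ρ z ∈ Icc (ρ xm) (ρ xM) := fun z hz => ⟨hmin hz, hmax hz⟩
  have hac : AbsolutelyContinuousOnInterval ρ a b := by
    rw [absolutelyContinuousOnInterval_iff] at hac0 ⊢
    intro ε hε
    obtain ⟨δ, hδ, h⟩ := hac0 ε hε
    refine ⟨δ, hδ, fun E hE hl => ?_⟩
    convert h E hE hl using 2 with i hi
    have := hE.1 i hi
    rw [uIcc_of_le hab.le] at this
    rw [h3 _ this.1, h3 _ this.2, dist_add_left]
  have hac2 := ac_comp hab.le hC hlip hmem hac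
  have hsub : uIcc x y ⊆ uIcc a b := by
    rw [uIcc_of_le hab.le]; exact uIcc_subset_Icc hx hy
  have hac3 := hac2.mono hsub
  rw [← hac3.integral_deriv_eq_sub]
  apply intervalIntegral.integral_congr_ae
  have e1 : ∀ᵐ z : ℝ, z ≠ a := by simp [ae_iff]
  have e2 : ∀ᵐ z : ℝ, z ≠ b := by simp [ae_iff]
  filter_upwards [h1.ae_hasDerivAt_integral, e1, e2] with z hz hza hzb hzm
  have hz1 : z ∈ Icc a b := by
    have := hsub (uIoc_subset_uIcc hzm); rwa [uIcc_of_le hab.le] at this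
  have hz2 : z ∈ Ioo a b := ⟨lt_of_le_of_ne hz1.1 (Ne.symm hza), lt_of_le_of_ne hz1.2 hzb⟩
  have hd := hz (by rwa [uIcc_of_le hab.le]) a left_mem_uIcc
  have hd2 : HasDerivAt ρ (ρx z) z := by
    refine (hd.const_add (ρ a)).congr_of_eventuallyEq ?_
    filter_upwards [Ioo_mem_nhds hz2.1 hz2.2] with w hw
    exact h3 w ⟨hw.1.le, hw.2.le⟩
  exact ((hF (ρ z) (hpos z hz1)).comp z hd2).deriv

lemma prim_deriv {f : ℝ → ℝ} (hf : ContinuousOn f (Ioi 0)) {c : ℝ} (hc : 0 < c) {x : ℝ}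
    (hx : 0 < x) : HasDerivAt (fun y => ∫ t in c..y, f t) (f x) x := by
  have hsub : uIcc c x ⊆ Ioi 0 := by
    intro z hz
    exact lt_of_lt_of_le (lt_min hc hx) hz.1
  apply intervalIntegral.integral_hasDerivAt_right
  · exact (hf.mono hsub).intervalIntegrable
  · exact hf.stronglyMeasurableAtFilter isOpen_Ioi x hx
  · exact hf.continuousAt (Ioi_mem_nhds hx)

lemma posii {f : ℝ → ℝ} (hf : ContinuousOn f (Ioi 0)) {c x : ℝ} (hc : 0 < c)
    (hx : 0 < x) : IntervalIntegrable f volume c x := by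
  refine (hf.mono ?_).intervalIntegrable
  intro z hz
  exact lt_of_lt_of_le (lt_min hc hx) hz.1

lemma int_inv_sq {c x : ℝ} (hc : 0 < c) (hx : 0 < x) (A : ℝ) :
    (∫ τ in c..x, A / τ ^ 2) = A / c - A / x := by
  have hcont : ContinuousOn (fun τ : ℝ => A / τ ^ 2) (Ioi 0) := by
    intro z hz
    have : z ≠ 0 := ne_of_gt hz
    exact ContinuousAt.continuousWithinAt (by fun_prop (disch := positivity))
  rw [intervalIntegral.integral_eq_sub_of_hasDerivAt (f := fun τ => - A / τ)
    _ (posii hcont hc hx)]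
  · ring
  · intro z hz
    have hz0 : 0 < z := lt_of_lt_of_le (lt_min hc hx) hz.1
    have := (hasDerivAt_inv hz0.ne').const_mul (-A)
    have e : A / z ^ 2 = -A * -(z ^ 2)⁻¹ := by ring
    rw [e]
    simpa only [div_eq_mul_inv] using this

lemma cont_P2 {P : ℝ → ℝ} (hP : ContinuousOn P (Ioi 0)) (A : ℝ) :
    ContinuousOn (fun τ => (P τ - A) / τ ^ 2) (Ioi 0) := by
  apply ContinuousOn.div (by fun_prop) (by fun_prop)
  intro z hz
  have : z ≠ 0 := ne_of_gt hz
  positivity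

lemma Qf_eq {P : ℝ → ℝ} (hP : ContinuousOn P (Ioi 0)) {ρs x : ℝ} (hρs : 0 < ρs) (hx : 0 < x) :
    Qf P ρs x = x * ∫ τ in ρs..x, (P τ - P ρs) / τ ^ 2 := by
  have h1 : (∫ τ in ρs..x, (P τ - P ρs) / τ ^ 2) =
      (∫ τ in ρs..x, P τ / τ ^ 2) - (∫ τ in ρs..x, P ρs / τ ^ 2) := by
    rw [← intervalIntegral.integral_sub]
    · congr 1; ext τ; ring
    · simpa using posii (cont_P2 hP 0) hρs hx
    · simpa using posii (cont_P2 (P := fun _ => P ρs) continuousOn_const 0) hρs hx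
  rw [h1, int_inv_sq hρs hx, Qf]
  field_simp
  ring

lemma Qf_nonneg {P : ℝ → ℝ} (hP : ContinuousOn P (Ioi 0)) (hmono : StrictMonoOn P (Ioi 0))
    {ρs x : ℝ} (hρs : 0 < ρs) (hx : 0 < x) : 0 ≤ Qf P ρs x := by
  rw [Qf_eq hP hρs hx]
  apply mul_nonneg hx.le
  rcases le_total ρs x with h | h
  · apply intervalIntegral.integral_nonneg h
    intro u hu
    have : P ρs ≤ P u := hmono.monotoneOn hρs (lt_of_lt_of_le hρs hu.1) hu.1
    have : 0 ≤ P u - P ρs := by linarith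
    positivity
  · rw [intervalIntegral.integral_symm, ← intervalIntegral.integral_neg]
    apply intervalIntegral.integral_nonneg h
    intro u hu
    have : P u ≤ P ρs := hmono.monotoneOn (lt_of_lt_of_le hx hu.1) hρs hu.2
    have : 0 ≤ P ρs - P u := by linarith
    rw [show -((P u - P ρs) / u ^ 2) = (P ρs - P u) / u ^ 2 by ring]
    positivity

lemma Qf_lower {P : ℝ → ℝ} (hP : ContinuousOn P (Ioi 0)) (hmono : StrictMonoOn P (Ioi 0))
    {ρs ρ1 x : ℝ} (h1 : ρ1 ≤ ρs) (hx : 0 < x) (hx1 : x ≤ ρ1) :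
    (P ρs - P ρ1) * (1 - x / ρ1) ≤ Qf P ρs x := by
  have hρ1 : 0 < ρ1 := hx.trans_le hx1
  have hρs : 0 < ρs := hρ1.trans_le h1
  have hc := cont_P2 hP (P ρs)
  rw [Qf_eq hP hρs hx, ← intervalIntegral.integral_add_adjacent_intervals
    (posii hc hρs hρ1) (posii hc hρ1 hx)]
  have i1 : 0 ≤ ∫ τ in ρs..ρ1, (P τ - P ρs) / τ ^ 2 := by
    rw [intervalIntegral.integral_symm, ← intervalIntegral.integral_neg]
    apply intervalIntegral.integral_nonneg h1
    intro u hu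
    have : P u ≤ P ρs := hmono.monotoneOn (lt_of_lt_of_le hρ1 hu.1) hρs hu.2
    have : 0 ≤ P ρs - P u := by linarith
    rw [show -((P u - P ρs) / u ^ 2) = (P ρs - P u) / u ^ 2 by ring]
    positivity
  have i2 : (P ρ1 - P ρs) / ρ1 - (P ρ1 - P ρs) / x ≤ ∫ τ in ρ1..x, (P τ - P ρs) / τ ^ 2 := by
    rw [← int_inv_sq hρ1 hx, intervalIntegral.integral_symm,
      intervalIntegral.integral_symm x ρ1]
    apply neg_le_neg
    apply intervalIntegral.integral_mono_on hx1 (posii hc hx hρ1)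
      (by simpa using posii (cont_P2 (P := fun _ => P ρ1 - P ρs) continuousOn_const 0) hx hρ1)
    intro u hu
    have : P u ≤ P ρ1 := hmono.monotoneOn (lt_of_lt_of_le hx hu.1) hρ1 hu.2
    gcongr
  calc (P ρs - P ρ1) * (1 - x / ρ1)
      = x * ((P ρ1 - P ρs) / ρ1 - (P ρ1 - P ρs) / x) := by field_simp; ring
    _ ≤ _ := by gcongr; linarith

lemma Qf_cont {P : ℝ → ℝ} (hP : ContinuousOn P (Ioi 0)) {ρs : ℝ} (hρs : 0 < ρs) :
    ContinuousOn (Qf P ρs) (Ioi 0) := by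
  have hc : ContinuousOn (fun τ => P τ / τ ^ 2) (Ioi 0) := by simpa using cont_P2 hP 0
  have : ContinuousOn (fun x => ∫ τ in ρs..x, P τ / τ ^ 2) (Ioi 0) := fun x hx =>
    (prim_deriv hc hρs hx).continuousAt.continuousWithinAt
  unfold Qf
  fun_prop

lemma Qf_upper {P : ℝ → ℝ} (hP : ContDiffOn ℝ 2 P (Ioi 0)) {ρs m M : ℝ} (hm : 0 < m)
    (hρs : ρs ∈ Icc m M) :
    ∃ C : ℝ, 0 < C ∧ ∀ x ∈ Icc m M, Qf P ρs x ≤ C * (x - ρs) ^ 2 := by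
  have hsub : Icc m M ⊆ Ioi 0 := fun x hx => lt_of_lt_of_le hm hx.1
  obtain ⟨K, hK⟩ := (hP.mono hsub).exists_lipschitzOnWith (by decide) (convex_Icc _ _)
    isCompact_Icc
  have hMp : 0 < M := hm.trans_le (hρs.1.trans hρs.2)
  refine ⟨M * ((K + 1) / m ^ 2), by positivity, fun x hx => ?_⟩
  rw [Qf_eq hP.continuousOn (hsub hρs) (hsub hx)]
  have hb : ‖∫ τ in ρs..x, (P τ - P ρs) / τ ^ 2‖ ≤ ((K + 1) * |x - ρs| / m ^ 2) * |x - ρs| := by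
    apply intervalIntegral.norm_integral_le_of_norm_le_const
    intro u hu
    have hu1 : u ∈ Icc m M := uIcc_subset_Icc hρs hx (uIoc_subset_uIcc hu)
    have h1 := hK.dist_le_mul u hu1 ρs hρs
    rw [Real.dist_eq, Real.dist_eq] at h1
    have h2 : |u - ρs| ≤ |x - ρs| := abs_sub_left_of_mem_uIcc (uIoc_subset_uIcc hu)
    rw [Real.norm_eq_abs, abs_div, abs_of_nonneg (sq_nonneg u)]
    have h0 : 0 ≤ (K : ℝ) := K.2
    have h3 : |P u - P ρs| ≤ (K + 1) * |x - ρs| := by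
      refine h1.trans ?_
      gcongr
      linarith
    have := hu1.1
    gcongr
  have h4 := (le_abs_self _).trans hb
  have h5 := hsub hx
  have h6 : 0 ≤ (K : ℝ) := K.2
  calc _ ≤ x * (((K + 1) * |x - ρs| / m ^ 2) * |x - ρs|) := by
        apply mul_le_mul_of_nonneg_left h4 (le_of_lt h5)
    _ ≤ M * (((K + 1) * |x - ρs| / m ^ 2) * |x - ρs|) := by
        gcongr; exact hx.2
    _ = M * ((K + 1) / m ^ 2) * (|x - ρs| ^ 2) := by ring
    _ = _ := by rw [sq_abs]

lemma kf_bounds {μ : ℝ → ℝ} (hμ : ContinuousOn μ (Ioi 0)) (hμpos : ∀ x, 0 < x → 0 < μ x)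
    {ρs m M : ℝ} (hm : 0 < m) (hρs : ρs ∈ Icc m M) :
    ∃ c₁ c₂ : ℝ, 0 < c₁ ∧ 0 < c₂ ∧ ∀ x ∈ Icc m M, c₁ ≤ μ x / x ∧ μ x / x ≤ c₂ ∧
      c₁ ^ 2 * (x - ρs) ^ 2 ≤ kf μ ρs x ^ 2 ∧ kf μ ρs x ^ 2 ≤ c₂ ^ 2 * (x - ρs) ^ 2 := by
  have hsub : Icc m M ⊆ Ioi 0 := fun x hx => lt_of_lt_of_le hm hx.1
  have hc : ContinuousOn (fun x => μ x / x) (Ioi 0) :=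
    hμ.div continuousOn_id (fun x hx => ne_of_gt hx)
  have hne : (Icc m M).Nonempty := ⟨ρs, hρs⟩
  obtain ⟨y1, hy1, hmin⟩ := isCompact_Icc.exists_isMinOn hne (hc.mono hsub)
  obtain ⟨y2, hy2, hmax⟩ := isCompact_Icc.exists_isMaxOn hne (hc.mono hsub)
  have p1 : 0 < μ y1 / y1 := div_pos (hμpos _ (hsub hy1)) (hsub hy1)
  have p2 : 0 < μ y2 / y2 := div_pos (hμpos _ (hsub hy2)) (hsub hy2)
  refine ⟨_, _, p1, p2, fun x hx => ⟨hmin hx, hmax hx, ?_⟩⟩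
  have hk : ∀ z, 0 < z → HasDerivAt (kf μ ρs) (μ z / z) z := fun z hz =>
    prim_deriv hc (hsub hρs) hz
  have hk0 : kf μ ρs ρs = 0 := by simp [kf]
  have key : ∃ z ∈ Icc m M, kf μ ρs x = (μ z / z) * (x - ρs) := by
    rcases lt_trichotomy x ρs with h | h | h
    · obtain ⟨z, hz, he⟩ := exists_hasDerivAt_eq_slope (kf μ ρs) (fun z => μ z / z) h
        (fun w hw => (hk w (lt_of_lt_of_le (hsub hx) hw.1)).continuousAt.continuousWithinAt)
        (fun w hw => hk w (lt_trans (hsub hx) hw.1))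
      refine ⟨z, ⟨hx.1.trans hz.1.le, hz.2.le.trans hρs.2⟩, ?_⟩
      rw [eq_div_iff (by linarith)] at he
      linarith
    · exact ⟨x, hx, by simp [h, hk0]⟩
    · obtain ⟨z, hz, he⟩ := exists_hasDerivAt_eq_slope (kf μ ρs) (fun z => μ z / z) h
        (fun w hw => (hk w (lt_of_lt_of_le (hsub hρs) hw.1)).continuousAt.continuousWithinAt)
        (fun w hw => hk w (lt_trans (hsub hρs) hw.1))
      refine ⟨z, ⟨hρs.1.trans hz.1.le, hz.2.le.trans hx.2⟩, ?_⟩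
      rw [eq_div_iff (by linarith)] at he
      linarith
  obtain ⟨z, hz, he⟩ := key
  have b1 : μ y1 / y1 ≤ μ z / z := hmin hz
  have b2 : μ z / z ≤ μ y2 / y2 := hmax hz
  rw [he, mul_pow]
  constructor <;> gcongr
  exact p1.le.trans b1

lemma comp_cont {f ρ : ℝ → ℝ} {a b : ℝ} (hf : ContinuousOn f (Ioi 0))
    (hρc : ContinuousOn ρ (Icc a b)) (hpos : ∀ x ∈ Icc a b, 0 < ρ x) :
    ContinuousOn (fun x => f (ρ x)) (Icc a b) :=
  hf.comp hρc (fun x hx => hpos x hx)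

lemma int_ests {μ ρ ρx v : ℝ → ℝ} {a b : ℝ} (hμ : ContinuousOn μ (Ioi 0)) (hab : a < b)
    (hρc : ContinuousOn ρ (Icc a b)) (hpos : ∀ x ∈ Icc a b, 0 < ρ x)
    (hH : H1On a b ρ ρx) (hv : ContinuousOn v (Icc a b)) :
    IntervalIntegrable (fun x => (ρ x)⁻¹ * (μ (ρ x) * (ρ x)⁻¹ * ρx x) ^ 2) volume a b ∧
    IntervalIntegrable (fun x => ρ x * (v x) ^ 2) volume a b ∧
    0 ≤ (∫ x in a..b, (ρ x)⁻¹ * (ρ x * v x + μ (ρ x) * (ρ x)⁻¹ * ρx x) ^ 2) ∧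
    0 ≤ (∫ x in a..b, ρ x * (v x) ^ 2) ∧
    (∫ x in a..b, (ρ x)⁻¹ * (μ (ρ x) * (ρ x)⁻¹ * ρx x) ^ 2) ≤
      2 * (∫ x in a..b, (ρ x)⁻¹ * (ρ x * v x + μ (ρ x) * (ρ x)⁻¹ * ρx x) ^ 2)
      + 2 * (∫ x in a..b, ρ x * (v x) ^ 2) ∧
    (∫ x in a..b, (ρ x)⁻¹ * (ρ x * v x + μ (ρ x) * (ρ x)⁻¹ * ρx x) ^ 2) ≤
      2 * (∫ x in a..b, (ρ x)⁻¹ * (μ (ρ x) * (ρ x)⁻¹ * ρx x) ^ 2)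
      + 2 * (∫ x in a..b, ρ x * (v x) ^ 2) := by
  obtain ⟨h1, h2, -⟩ := hH
  have hu : uIcc a b = Icc a b := uIcc_of_le hab.le
  have hμρ := comp_cont hμ hρc hpos
  have hinv : ContinuousOn (fun x => (ρ x)⁻¹) (Icc a b) :=
    hρc.inv₀ (fun x hx => (hpos x hx).ne')
  have iD : IntervalIntegrable (fun x => (ρ x)⁻¹ * (μ (ρ x) * (ρ x)⁻¹ * ρx x) ^ 2) volume a b := by
    have : ContinuousOn (fun x => (ρ x)⁻¹ * (μ (ρ x) * (ρ x)⁻¹) ^ 2) (uIcc a b) := by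
      rw [hu]; exact hinv.mul ((hμρ.mul hinv).pow 2)
    refine (h2.continuousOn_mul this).congr (fun x _ => ?_)
    ring
  have iB : IntervalIntegrable (fun x => ρ x * (v x) ^ 2) volume a b := by
    apply ContinuousOn.intervalIntegrable
    rw [hu]; fun_prop
  have iA : IntervalIntegrable
      (fun x => (ρ x)⁻¹ * (ρ x * v x + μ (ρ x) * (ρ x)⁻¹ * ρx x) ^ 2) volume a b := by
    have : ContinuousOn (fun x => 2 * v x * (μ (ρ x) * (ρ x)⁻¹)) (uIcc a b) := by
      rw [hu]; exact (hv.const_mul 2).mul (hμρ.mul hinv)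
    refine ((iB.add (h1.continuousOn_mul this)).add iD).congr (fun x hx => ?_)
    have hx' : x ∈ Icc a b := by rw [← hu]; exact uIoc_subset_uIcc hx
    have := hpos x hx'
    field_simp
    ring
  refine ⟨iD, iB, ?_, ?_, ?_, ?_⟩
  · apply intervalIntegral.integral_nonneg hab.le
    intro x hx
    have := hpos x hx
    positivity
  · apply intervalIntegral.integral_nonneg hab.le
    intro x hx
    have := hpos x hx
    positivity
  · rw [← intervalIntegral.integral_const_mul, ← intervalIntegral.integral_const_mul,
      ← intervalIntegral.integral_add (iA.const_mul 2) (iB.const_mul 2)]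
    apply intervalIntegral.integral_mono_on hab.le iD ((iA.const_mul 2).add (iB.const_mul 2))
    intro x hx
    have hp := hpos x hx
    have e : ρ x * v x ^ 2 = (ρ x)⁻¹ * (ρ x * v x) ^ 2 := by field_simp
    rw [e]
    have : 0 ≤ (ρ x)⁻¹ * (2 * (ρ x * v x) + μ (ρ x) * (ρ x)⁻¹ * ρx x) ^ 2 := by positivity
    nlinarith
  · rw [← intervalIntegral.integral_const_mul, ← intervalIntegral.integral_const_mul,
      ← intervalIntegral.integral_add (iD.const_mul 2) (iB.const_mul 2)]
    apply intervalIntegral.integral_mono_on hab.le iA ((iD.const_mul 2).add (iB.const_mul 2))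
    intro x hx
    have hp := hpos x hx
    have e : ρ x * v x ^ 2 = (ρ x)⁻¹ * (ρ x * v x) ^ 2 := by field_simp
    rw [e]
    have : 0 ≤ (ρ x)⁻¹ * ((ρ x * v x) - μ (ρ x) * (ρ x)⁻¹ * ρx x) ^ 2 := by positivity
    nlinarith

lemma G_diff {P μ ρ ρx : ℝ → ℝ} {ρs a b : ℝ} (hP : ContinuousOn P (Ioi 0))
    (hmono : StrictMonoOn P (Ioi 0)) (hμ : ContinuousOn μ (Ioi 0))
    (hρs : 0 < ρs) (hab : a < b)
    (hρc : ContinuousOn ρ (Icc a b)) (hpos : ∀ x ∈ Icc a b, 0 < ρ x)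
    (hH : H1On a b ρ ρx) {x y : ℝ} (hx : x ∈ Icc a b) (hy : y ∈ Icc a b) :
    |Gf P μ ρs (ρ y) - Gf P μ ρs (ρ x)| ≤
      (∫ x in a..b, (ρ x)⁻¹ * (μ (ρ x) * (ρ x)⁻¹ * ρx x) ^ 2) + Uf P ρs a b ρ := by
  have hQ := Qf_cont hP hρs
  have hg : ContinuousOn (fun l => μ l / l ^ ((3 : ℝ) / 2) * Real.sqrt (Qf P ρs l)) (Ioi 0) := by
    apply ContinuousOn.mul _ hQ.sqrt
    apply hμ.div
    · intro z hz
      exact (Real.continuousAt_rpow_const z _ (Or.inl (ne_of_gt hz))).continuousWithinAt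
    · intro z hz
      exact (Real.rpow_pos_of_pos hz _).ne'
  have hc := chain_rule (F := Gf P μ ρs) hab (fun z hz => prim_deriv hg hρs hz) hg hρc hpos hH hx hy
  rw [hc]
  have iD := (int_ests hμ hab hρc hpos hH (v := fun _ => 0) continuousOn_const).1
  have iU : IntervalIntegrable (fun x => Qf P ρs (ρ x)) volume a b := by
    apply ContinuousOn.intervalIntegrable
    rw [uIcc_of_le hab.le]
    exact comp_cont hQ hρc hpos
  have iS := iD.add iU
  unfold Uf
  rw [← intervalIntegral.integral_add iD iU]
  have hnn : ∀ s ∈ Icc a b, 0 ≤ (ρ s)⁻¹ * (μ (ρ s) * (ρ s)⁻¹ * ρx s) ^ 2 + Qf P ρs (ρ s) := by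
    intro s hs
    have := hpos s hs
    have := Qf_nonneg hP hmono hρs (hpos s hs)
    positivity
  have hsub : uIcc x y ⊆ uIcc a b := by
    rw [uIcc_of_le hab.le]; exact uIcc_subset_Icc hx hy
  have hsub2 : uIoc x y ⊆ uIoc a b := by
    rw [uIoc_of_le hab.le, uIoc]
    exact Ioc_subset_Ioc (le_min hx.1 hy.1) (max_le hx.2 hy.2)
  have st1 : ‖∫ s in x..y, μ (ρ s) / ρ s ^ ((3 : ℝ) / 2) * Real.sqrt (Qf P ρs (ρ s)) * ρx s‖ ≤
      |∫ s in x..y, ((ρ s)⁻¹ * (μ (ρ s) * (ρ s)⁻¹ * ρx s) ^ 2 + Qf P ρs (ρ s))| := by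
    apply intervalIntegral.norm_integral_le_abs_of_norm_le
    · apply ae_restrict_of_forall_mem measurableSet_uIoc
      intro s hs
      have hs' : s ∈ Icc a b := by
        rw [← uIcc_of_le hab.le]; exact hsub (uIoc_subset_uIcc hs)
      have hp := hpos s hs'
      have hq := Qf_nonneg hP hmono hρs hp
      have hsq := Real.sq_sqrt hq
      set w := Real.sqrt (Qf P ρs (ρ s))
      have h3 : (ρ s ^ ((3 : ℝ) / 2)) ^ 2 = ρ s ^ 3 := by
        rw [← Real.rpow_natCast, ← Real.rpow_mul hp.le, ← Real.rpow_natCast]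
        norm_num
      have hpp : 0 < ρ s ^ ((3 : ℝ) / 2) := Real.rpow_pos_of_pos hp _
      set t := ρ s ^ ((3 : ℝ) / 2)
      have e : (ρ s)⁻¹ * (μ (ρ s) * (ρ s)⁻¹ * ρx s) ^ 2 = (μ (ρ s) / t * ρx s) ^ 2 := by
        rw [mul_pow, mul_pow, mul_pow, div_pow, h3]
        field_simp
      rw [e, ← hsq, Real.norm_eq_abs, abs_le]
      constructor <;> nlinarith [sq_nonneg (μ (ρ s) / t * ρx s - w),
        sq_nonneg (μ (ρ s) / t * ρx s + w)]
    · exact iS.mono_set hsub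
  have st2 : |∫ s in x..y, ((ρ s)⁻¹ * (μ (ρ s) * (ρ s)⁻¹ * ρx s) ^ 2 + Qf P ρs (ρ s))| ≤
      |∫ s in a..b, ((ρ s)⁻¹ * (μ (ρ s) * (ρ s)⁻¹ * ρx s) ^ 2 + Qf P ρs (ρ s))| := by
    apply intervalIntegral.abs_integral_mono_interval hsub2 _ iS
    apply ae_restrict_of_forall_mem measurableSet_uIoc
    intro s hs
    rw [uIoc_of_le hab.le] at hs
    exact hnn s ⟨hs.1.le, hs.2⟩
  rw [abs_of_nonneg (intervalIntegral.integral_nonneg hab.le hnn)] at st2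
  exact st1.trans st2

lemma G_mono {P μ : ℝ → ℝ} {ρs : ℝ} (hP : ContinuousOn P (Ioi 0))
    (hμ : ContinuousOn μ (Ioi 0)) (hμpos : ∀ x, 0 < x → 0 < μ x)
    (hρs : 0 < ρs) {x y : ℝ} (hx : 0 < x) (hxy : x ≤ y) :
    Gf P μ ρs x ≤ Gf P μ ρs y := by
  have hQ := Qf_cont hP hρs
  have hg : ContinuousOn (fun l => μ l / l ^ ((3 : ℝ) / 2) * Real.sqrt (Qf P ρs l)) (Ioi 0) := by
    apply ContinuousOn.mul _ hQ.sqrt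
    apply hμ.div
    · intro z hz
      exact (Real.continuousAt_rpow_const z _ (Or.inl (ne_of_gt hz))).continuousWithinAt
    · intro z hz
      exact (Real.rpow_pos_of_pos hz _).ne'
  have hy := hx.trans_le hxy
  have := intervalIntegral.integral_add_adjacent_intervals (posii hg hρs hx) (posii hg hx hy)
  have h0 : 0 ≤ ∫ l in x..y, μ l / l ^ ((3 : ℝ) / 2) * Real.sqrt (Qf P ρs l) := by
    apply intervalIntegral.integral_nonneg hxy
    intro l hl
    have hl0 : 0 < l := hx.trans_le hl.1
    have := hμpos l hl0
    positivity
  unfold Gf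
  linarith

lemma V_parts {P μ ρ ρx v : ℝ → ℝ} {ρs a b r S : ℝ} (hP : ContinuousOn P (Ioi 0))
    (hmono : StrictMonoOn P (Ioi 0)) (hμ : ContinuousOn μ (Ioi 0))
    (hρs : 0 < ρs) (hr : 0 < r) (hab : a < b)
    (hρc : ContinuousOn ρ (Icc a b)) (hpos : ∀ x ∈ Icc a b, 0 < ρ x)
    (hH : H1On a b ρ ρx) (hv : ContinuousOn v (Icc a b))
    (hV : Vf P μ ρs r a b ρ ρx v ≤ S) :
    (v a) ^ 2 ≤ 2 / r * S ∧ (v b) ^ 2 ≤ 2 / r * S ∧ 0 ≤ Uf P ρs a b ρ ∧ Uf P ρs a b ρ ≤ S ∧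
    (∫ x in a..b, ρ x * (v x) ^ 2) ≤ 2 / r * S ∧
    (∫ x in a..b, (ρ x)⁻¹ * (μ (ρ x) * (ρ x)⁻¹ * ρx x) ^ 2) ≤ (4 + 4 / r) * S ∧
    (kf μ ρs (ρ a)) ^ 2 ≤ (4 + 4 / r) * S := by
  obtain ⟨-, -, hA, hB, hD, -⟩ := int_ests hμ hab hρc hpos hH hv
  have hU : 0 ≤ Uf P ρs a b ρ := intervalIntegral.integral_nonneg hab.le
    (fun x hx => Qf_nonneg hP hmono hρs (hpos x hx))
  unfold Vf Wf Ef at hV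
  set A := ∫ x in a..b, (ρ x)⁻¹ * (ρ x * v x + μ (ρ x) * (ρ x)⁻¹ * ρx x) ^ 2
  set B := ∫ x in a..b, ρ x * (v x) ^ 2
  set D := ∫ x in a..b, (ρ x)⁻¹ * (μ (ρ x) * (ρ x)⁻¹ * ρx x) ^ 2
  set U := Uf P ρs a b ρ
  have n1 := sq_nonneg (v b - kf μ ρs (ρ b))
  have n2 := sq_nonneg (v a + kf μ ρs (ρ a))
  have n3 := mul_nonneg hr.le (sq_nonneg (v a))
  have n4 := mul_nonneg hr.le (sq_nonneg (v b))
  have n5 := mul_nonneg hr.le hB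
  have n6 := mul_nonneg hr.le hU
  have hva : (v a) ^ 2 ≤ 2 / r * S := by
    rw [div_mul_eq_mul_div, le_div_iff₀ hr]; nlinarith
  have hvb : (v b) ^ 2 ≤ 2 / r * S := by
    rw [div_mul_eq_mul_div, le_div_iff₀ hr]; nlinarith
  have hBS : B ≤ 2 / r * S := by
    rw [div_mul_eq_mul_div, le_div_iff₀ hr]; nlinarith
  have hAS : A ≤ 2 * S := by nlinarith
  have hkS : (v a + kf μ ρs (ρ a)) ^ 2 ≤ 2 * S := by nlinarith
  have e : (4 + 4 / r) * S = 4 * S + 2 * (2 / r * S) := by ring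
  refine ⟨hva, hvb, hU, by nlinarith, hBS, ?_, ?_⟩
  · rw [e]; linarith
  · rw [e]; nlinarith [sq_nonneg (2 * v a + kf μ ρs (ρ a))]

lemma apriori {P μ : ℝ → ℝ} {ρs r S : ℝ} (hP : ContinuousOn P (Ioi 0))
    (hmono : StrictMonoOn P (Ioi 0)) (hμ : ContinuousOn μ (Ioi 0))
    (hμpos : ∀ x, 0 < x → 0 < μ x)
    (hρs : 0 < ρs) (hr : 0 < r) (hS : 0 ≤ S) (hH : AssumpH P μ ρs) :
    ∃ m M : ℝ, 0 < m ∧ ρs ∈ Icc m M ∧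
      ∀ (a b : ℝ) (ρ ρx v : ℝ → ℝ), a < b →
        ContinuousOn ρ (Icc a b) → (∀ x ∈ Icc a b, 0 < ρ x) →
        H1On a b ρ ρx →
        ContinuousOn v (Icc a b) →
        (∫ x in a..b, ρ x) = 1 →
        Vf P μ ρs r a b ρ ρx v ≤ S → ∀ x ∈ Icc a b, ρ x ∈ Icc m M := by
  obtain ⟨hG1, hG2, hk⟩ := hH
  set K := (4 + 4 / r) * S with hK
  have hK0 : 0 ≤ K := by positivity
  obtain ⟨M1, hM1⟩ := eventually_atTop.1 (hk.eventually_gt_atTop (K + 1))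
  set M1' := max M1 1
  obtain ⟨M2, hM2⟩ := eventually_atTop.1
    (hG1.eventually_gt_atTop (Gf P μ ρs M1' + (K + S)))
  set δ := P ρs - P (ρs / 2) with hδ
  have hδ0 : 0 < δ := by
    have := hmono (show ρs / 2 ∈ Ioi 0 from half_pos hρs) hρs (by linarith); linarith
  set m0 := min (ρs / 4) (δ / (4 * (S + 1))) with hm0
  have hm0p : 0 < m0 := by positivity
  have hev := hG2.eventually_lt_atBot (Gf P μ ρs m0 - (K + S))
  rw [eventually_nhdsWithin_iff, Metric.eventually_nhds_iff] at hev
  obtain ⟨ε, hε, hm2⟩ := hev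
  refine ⟨min ε ρs, max M2 ρs, lt_min hε hρs, ⟨min_le_right _ _, le_max_right _ _⟩, ?_⟩
  intro a b ρ ρx v hab hρc hpos hH1 hv hmass hV x hx
  obtain ⟨-, -, hU0, hU, -, hD, hka⟩ := V_parts hP hmono hμ hρs hr hab hρc hpos hH1 hv hV
  have ha : a ∈ Icc a b := left_mem_Icc.2 hab.le
  have hdiff : ∀ y ∈ Icc a b, |Gf P μ ρs (ρ x) - Gf P μ ρs (ρ y)| ≤ K + S := fun y hy =>
    (G_diff hP hmono hμ hρs hab hρc hpos hH1 hy hx).trans (by linarith)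
  constructor
  · -- lower bound
    have hex : ∃ y ∈ Icc a b, m0 ≤ ρ y := by
      by_contra! hcon
      have hL : 1 ≤ m0 * (b - a) := by
        have : (∫ x in a..b, ρ x) ≤ ∫ x in a..b, m0 := by
          apply intervalIntegral.integral_mono_on hab.le
          · apply ContinuousOn.intervalIntegrable; rwa [uIcc_of_le hab.le]
          · simp
          · intro z hz; exact (hcon z hz).le
        rw [hmass] at this
        simp at this
        linarith
      have hUl : (b - a) * (δ / 2) ≤ Uf P ρs a b ρ := by
        have : (∫ x in a..b, δ / 2) ≤ ∫ x in a..b, Qf P ρs (ρ x) := by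
          apply intervalIntegral.integral_mono_on hab.le
          · simp
          · apply ContinuousOn.intervalIntegrable
            rw [uIcc_of_le hab.le]
            exact comp_cont (Qf_cont hP hρs) hρc hpos
          · intro z hz
            have h1 := (hcon z hz).le.trans (min_le_left _ _)
            have h2 := Qf_lower hP hmono (ρs := ρs) (ρ1 := ρs / 2) (by linarith) (hpos z hz)
              (by linarith)
            refine le_trans ?_ h2
            have : ρ z / (ρs / 2) ≤ 1 / 2 := by
              rw [div_le_iff₀ (by positivity)]; linarith
            rw [← hδ]
            nlinarith
        simp only [intervalIntegral.integral_const, smul_eq_mul] at this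
        exact this
      have h1 : m0 * (4 * (S + 1)) ≤ δ := by
        rw [← le_div_iff₀ (by positivity)]; exact min_le_right _ _
      have h2 : m0 * (4 * (S + 1)) * (b - a) ≤ δ * (b - a) :=
        mul_le_mul_of_nonneg_right h1 (by linarith)
      nlinarith
    obtain ⟨y, hy, hmy⟩ := hex
    by_contra! hlt
    have hlt' : ρ x < ε := hlt.trans_le (min_le_left _ _)
    have h1 := hm2 (y := ρ x) (by
      rw [Real.dist_eq, sub_zero, abs_of_pos (hpos x hx)]; exact hlt') (hpos x hx)
    have h2 := (abs_le.1 (hdiff y hy)).1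
    have h3 := G_mono (P := P) hP hμ hμpos hρs hm0p hmy
    linarith
  · by_contra! hlt
    have h1 := hM2 (ρ x) ((le_max_left _ _).trans hlt.le)
    have h2 := (abs_le.1 (hdiff a ha)).2
    have hra : ρ a ≤ M1' := by
      by_contra! hc
      have h4 := hM1 (ρ a) ((le_max_left _ _).trans hc.le)
      nlinarith
    have h3 := G_mono (P := P) hP hμ hμpos hρs (hpos a ha) hra
    linarith

lemma sq_int_le {f : ℝ → ℝ} {a b : ℝ} (hab : a ≤ b)
    (h1 : IntervalIntegrable f volume a b)
    (h2 : IntervalIntegrable (fun s => (f s) ^ 2) volume a b) :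
    (∫ s in a..b, f s) ^ 2 ≤ (b - a) * ∫ s in a..b, (f s) ^ 2 := by
  rcases hab.eq_or_lt with h | h
  · simp [h]
  set I := ∫ s in a..b, f s with hI
  set J := ∫ s in a..b, (f s) ^ 2 with hJ
  have hL : 0 < b - a := by linarith
  have h0 : 0 ≤ ∫ s in a..b, ((b - a) * f s - I) ^ 2 :=
    intervalIntegral.integral_nonneg hab (fun s _ => sq_nonneg _)
  have e : (∫ s in a..b, ((b - a) * f s - I) ^ 2) =
      (b - a) ^ 2 * J - (2 * (b - a) * I) * I + (b - a) * I ^ 2 := by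
    have e1 : (fun s => ((b - a) * f s - I) ^ 2) =
        fun s => ((b - a) ^ 2 * (f s) ^ 2 - (2 * (b - a) * I) * f s) + I ^ 2 := by
      ext s; ring
    rw [e1, intervalIntegral.integral_add ((h2.const_mul _).sub (h1.const_mul _)) (by simp),
      intervalIntegral.integral_sub (h2.const_mul _) (h1.const_mul _),
      intervalIntegral.integral_const_mul, intervalIntegral.integral_const_mul]
    simp [hI, hJ]
  rw [e] at h0
  have h3 : 0 ≤ (b - a) * ((b - a) * J - I ^ 2) := by nlinarith
  have := nonneg_of_mul_nonneg_right h3 hL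
  linarith

set_option maxHeartbeats 1000000 in
lemma final_ineq {P μ ρ ρx v : ℝ → ℝ} {ρs a b r m M c₁ c₂ CQ : ℝ} (hP : ContinuousOn P (Ioi 0))
    (hmono : StrictMonoOn P (Ioi 0)) (hμ : ContinuousOn μ (Ioi 0))
    (hρs : 0 < ρs) (hr : 0 < r) (hm : 0 < m) (hmM : m ≤ M) (hc₁ : 0 < c₁) (hc₂ : 0 < c₂)
    (hCQ : 0 < CQ) (hQ : ∀ x ∈ Icc m M, Qf P ρs x ≤ CQ * (x - ρs) ^ 2)
    (hk : ∀ x ∈ Icc m M, c₁ ≤ μ x / x ∧ μ x / x ≤ c₂ ∧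
      c₁ ^ 2 * (x - ρs) ^ 2 ≤ kf μ ρs x ^ 2 ∧ kf μ ρs x ^ 2 ≤ c₂ ^ 2 * (x - ρs) ^ 2)
    (hab : a < b)
    (hρc : ContinuousOn ρ (Icc a b)) (hpos : ∀ x ∈ Icc a b, 0 < ρ x)
    (hH : H1On a b ρ ρx) (hv : ContinuousOn v (Icc a b))
    (hmass : (∫ x in a..b, ρ x) = 1)
    (hb : ∀ x ∈ Icc a b, ρ x ∈ Icc m M) :
    ((b - a) * (∫ x in a..b, (ρx x) ^ 2)
              + (sSup ((fun x => |ρ x - ρs|) '' Icc a b)) ^ 2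
              + (v a) ^ 2 + (v b) ^ 2 + (b - a)⁻¹ * (∫ x in a..b, (v x) ^ 2)) ≤
      ((m⁻¹ * M * c₁⁻¹ ^ 2 * (4 + 4 / r)) * 3 + 2 * c₁⁻¹ ^ 2 * (4 + 4 / r)
        + 2 / r + 2 / r + M * m⁻¹ * (2 / r)) * Vf P μ ρs r a b ρ ρx v ∧
    Vf P μ ρs r a b ρ ρx v ≤
      (c₂ ^ 2 * m⁻¹ * M + (2 * c₂ ^ 2 + (1 + r) * CQ * m⁻¹) + (1 + r) + (1 + r)
        + (1 + r) * M * m⁻¹) *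
      ((b - a) * (∫ x in a..b, (ρx x) ^ 2)
              + (sSup ((fun x => |ρ x - ρs|) '' Icc a b)) ^ 2
              + (v a) ^ 2 + (v b) ^ 2 + (b - a)⁻¹ * (∫ x in a..b, (v x) ^ 2)) := by
  have hM : 0 < M := hm.trans_le hmM
  have hu : uIcc a b = Icc a b := uIcc_of_le hab.le
  have ha : a ∈ Icc a b := left_mem_Icc.2 hab.le
  have hbb : b ∈ Icc a b := right_mem_Icc.2 hab.le
  have iρ : IntervalIntegrable ρ volume a b := by
    apply ContinuousOn.intervalIntegrable; rwa [hu]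
  have iv : IntervalIntegrable (fun x => (v x) ^ 2) volume a b := by
    apply ContinuousOn.intervalIntegrable; rw [hu]; exact hv.pow 2
  obtain ⟨p1, p2, p3, p4, p5, p6, p7⟩ :=
    V_parts hP hmono hμ hρs hr hab hρc hpos hH hv le_rfl
  obtain ⟨iD, iB, hA0, hB0, -, hA⟩ := int_ests hμ hab hρc hpos hH hv
  obtain ⟨h1, h2, h3⟩ := hH
  have hL : 0 < b - a := by linarith
  have hmL : m * (b - a) ≤ 1 := by
    have : (∫ x in a..b, m) ≤ ∫ x in a..b, ρ x :=
      intervalIntegral.integral_mono_on hab.le (by simp) iρ (fun x hx => (hb x hx).1)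
    simp only [intervalIntegral.integral_const, smul_eq_mul, hmass] at this
    linarith
  have hML : 1 ≤ M * (b - a) := by
    have : (∫ x in a..b, ρ x) ≤ ∫ x in a..b, M :=
      intervalIntegral.integral_mono_on hab.le iρ (by simp) (fun x hx => (hb x hx).2)
    simp only [intervalIntegral.integral_const, smul_eq_mul, hmass] at this
    linarith
  have hL1 : b - a ≤ m⁻¹ := by
    rw [← one_div, le_div_iff₀ hm]; linarith
  have hL2 : (b - a)⁻¹ ≤ M := by
    rw [← one_div, div_le_iff₀ hL]; linarith
  -- supremum
  have hcabs : ContinuousOn (fun x => |ρ x - ρs|) (Icc a b) := (hρc.sub continuousOn_const).abs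
  have hbdd : BddAbove ((fun x => |ρ x - ρs|) '' Icc a b) :=
    (isCompact_Icc.image_of_continuousOn hcabs).bddAbove
  set s := sSup ((fun x => |ρ x - ρs|) '' Icc a b) with hs
  have hle : ∀ x ∈ Icc a b, (ρ x - ρs) ^ 2 ≤ s ^ 2 := by
    intro x hx
    have : |ρ x - ρs| ≤ s := le_csSup hbdd ⟨x, hx, rfl⟩
    rw [← sq_abs]
    gcongr
  set X1 := ∫ x in a..b, (ρx x) ^ 2 with hX1
  set X3 := ∫ x in a..b, (v x) ^ 2 with hX3
  have hX10 : 0 ≤ X1 := intervalIntegral.integral_nonneg hab.le (fun x _ => sq_nonneg _)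
  have hX30 : 0 ≤ X3 := intervalIntegral.integral_nonneg hab.le (fun x _ => sq_nonneg _)
  have hsup : s ^ 2 ≤ 2 * (ρ a - ρs) ^ 2 + 2 * ((b - a) * X1) := by
    obtain ⟨x, hx, hxs⟩ := (isCompact_Icc.image_of_continuousOn hcabs).sSup_mem
      ((nonempty_Icc.2 hab.le).image _)
    have e : s ^ 2 = (ρ x - ρs) ^ 2 := by
      rw [hs, ← hxs]; exact sq_abs _
    have hax : uIcc a x ⊆ uIcc a b := by
      rw [hu, uIcc_of_le hx.1]; exact Icc_subset_Icc_right hx.2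
    have i1 := sq_int_le hx.1 (h1.mono_set hax) (h2.mono_set hax)
    have i2 : (∫ s in a..x, (ρx s) ^ 2) ≤ X1 := by
      apply intervalIntegral.integral_mono_interval le_rfl hx.1 hx.2 _ h2
      exact Eventually.of_forall (fun s => sq_nonneg _)
    have i3 : (x - a) * (∫ s in a..x, (ρx s) ^ 2) ≤ (b - a) * X1 := by
      apply mul_le_mul (by linarith [hx.2]) i2 _ hL.le
      exact intervalIntegral.integral_nonneg hx.1 (fun x _ => sq_nonneg _)
    rw [e, h3 x hx]
    nlinarith [sq_nonneg ((ρ a - ρs) - ∫ s in a..x, ρx s)]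
  set D := ∫ x in a..b, (ρ x)⁻¹ * (μ (ρ x) * (ρ x)⁻¹ * ρx x) ^ 2 with hDdef
  set B := ∫ x in a..b, ρ x * (v x) ^ 2 with hBdef
  have hD1 : X1 ≤ M * c₁⁻¹ ^ 2 * D := by
    rw [hDdef, ← intervalIntegral.integral_const_mul]
    apply intervalIntegral.integral_mono_on hab.le h2 (iD.const_mul _)
    intro x hx
    have hp := hpos x hx
    obtain ⟨k1, -, -, -⟩ := hk _ (hb x hx)
    rw [div_eq_mul_inv] at k1
    have q1 : M⁻¹ ≤ (ρ x)⁻¹ := by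
      have := (hb x hx).2
      gcongr
    calc ρx x ^ 2 = M * c₁⁻¹ ^ 2 * (M⁻¹ * (c₁ ^ 2 * ρx x ^ 2)) := by field_simp
      _ ≤ M * c₁⁻¹ ^ 2 * ((ρ x)⁻¹ * ((μ (ρ x) * (ρ x)⁻¹) ^ 2 * ρx x ^ 2)) := by gcongr
      _ = _ := by ring
  have hD2 : D ≤ c₂ ^ 2 * m⁻¹ * X1 := by
    rw [hX1, ← intervalIntegral.integral_const_mul]
    apply intervalIntegral.integral_mono_on hab.le iD (h2.const_mul _)
    intro x hx
    have hp := hpos x hx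
    obtain ⟨k1, k2, -, -⟩ := hk _ (hb x hx)
    rw [div_eq_mul_inv] at k1 k2
    have q1 : (ρ x)⁻¹ ≤ m⁻¹ := by
      have := (hb x hx).1
      gcongr
    have q2 := hc₁.le.trans k1
    calc (ρ x)⁻¹ * (μ (ρ x) * (ρ x)⁻¹ * ρx x) ^ 2
        = (ρ x)⁻¹ * ((μ (ρ x) * (ρ x)⁻¹) ^ 2 * ρx x ^ 2) := by ring
      _ ≤ m⁻¹ * (c₂ ^ 2 * ρx x ^ 2) := by gcongr
      _ = _ := by ring
  have hB1 : X3 ≤ m⁻¹ * B := by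
    rw [hBdef, ← intervalIntegral.integral_const_mul]
    apply intervalIntegral.integral_mono_on hab.le iv (iB.const_mul _)
    intro x hx
    have := (hb x hx).1
    calc v x ^ 2 = m⁻¹ * (m * v x ^ 2) := by field_simp
      _ ≤ _ := by gcongr
  have hB2 : B ≤ M * X3 := by
    rw [hX3, ← intervalIntegral.integral_const_mul]
    apply intervalIntegral.integral_mono_on hab.le iB (iv.const_mul _)
    intro x hx
    have := (hb x hx).2
    gcongr
  have hU : Uf P ρs a b ρ ≤ CQ * m⁻¹ * s ^ 2 := by
    have : Uf P ρs a b ρ ≤ ∫ x in a..b, CQ * s ^ 2 := by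
      apply intervalIntegral.integral_mono_on hab.le
      · apply ContinuousOn.intervalIntegrable
        rw [hu]
        exact comp_cont (Qf_cont hP hρs) hρc hpos
      · simp
      · intro x hx
        exact (hQ _ (hb x hx)).trans (mul_le_mul_of_nonneg_left (hle x hx) hCQ.le)
    simp only [intervalIntegral.integral_const, smul_eq_mul] at this
    refine this.trans ?_
    calc (b - a) * (CQ * s ^ 2) ≤ m⁻¹ * (CQ * s ^ 2) := by gcongr
      _ = _ := by ring
  set V := Vf P μ ρs r a b ρ ρx v with hVdef
  constructor
  · have t1 : (b - a) * X1 ≤ (m⁻¹ * M * c₁⁻¹ ^ 2 * (4 + 4 / r)) * V := by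
      calc (b - a) * X1 ≤ m⁻¹ * (M * c₁⁻¹ ^ 2 * ((4 + 4 / r) * V)) := by
            apply mul_le_mul hL1 (hD1.trans _) hX10 (by positivity)
            gcongr
        _ = _ := by ring
    have t2 : (ρ a - ρs) ^ 2 ≤ c₁⁻¹ ^ 2 * (4 + 4 / r) * V := by
      calc (ρ a - ρs) ^ 2 = c₁⁻¹ ^ 2 * (c₁ ^ 2 * (ρ a - ρs) ^ 2) := by field_simp
        _ ≤ c₁⁻¹ ^ 2 * ((4 + 4 / r) * V) := by
            exact mul_le_mul_of_nonneg_left ((hk _ (hb a ha)).2.2.1.trans p7) (sq_nonneg _)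
        _ = _ := by ring
    have t3 : (b - a)⁻¹ * X3 ≤ M * m⁻¹ * (2 / r) * V := by
      calc (b - a)⁻¹ * X3 ≤ M * (m⁻¹ * (2 / r * V)) := by
            apply mul_le_mul hL2 (hB1.trans _) hX30 hM.le
            gcongr
        _ = _ := by ring
    linarith
  · have t1 : D ≤ c₂ ^ 2 * m⁻¹ * M * ((b - a) * X1) := by
      have : X1 ≤ M * (b - a) * X1 := le_mul_of_one_le_left hX10 hML
      calc D ≤ _ := hD2
        _ ≤ c₂ ^ 2 * m⁻¹ * (M * (b - a) * X1) := by gcongr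
        _ = _ := by ring
    have t3 : B ≤ M * m⁻¹ * ((b - a)⁻¹ * X3) := by
      calc B ≤ M * X3 := hB2
        _ = M * ((b - a) * ((b - a)⁻¹ * X3)) := by field_simp
        _ ≤ M * (m⁻¹ * ((b - a)⁻¹ * X3)) := by gcongr
        _ = _ := by ring
    have ka : kf μ ρs (ρ a) ^ 2 ≤ c₂ ^ 2 * s ^ 2 :=
      (hk _ (hb a ha)).2.2.2.trans (mul_le_mul_of_nonneg_left (hle a ha) (sq_nonneg _))
    have kb : kf μ ρs (ρ b) ^ 2 ≤ c₂ ^ 2 * s ^ 2 :=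
      (hk _ (hb b hbb)).2.2.2.trans (mul_le_mul_of_nonneg_left (hle b hbb) (sq_nonneg _))
    have w1 : (1 / 2) * (v b - kf μ ρs (ρ b)) ^ 2 ≤ v b ^ 2 + c₂ ^ 2 * s ^ 2 := by
      linarith [sq_nonneg (v b + kf μ ρs (ρ b)), add_sq (v b) (kf μ ρs (ρ b)),
        sub_sq (v b) (kf μ ρs (ρ b))]
    have w2 : (1 / 2) * (v a + kf μ ρs (ρ a)) ^ 2 ≤ v a ^ 2 + c₂ ^ 2 * s ^ 2 := by
      linarith [sq_nonneg (v a - kf μ ρs (ρ a)), add_sq (v a) (kf μ ρs (ρ a)),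
        sub_sq (v a) (kf μ ρs (ρ a))]
    have hY1 : 0 ≤ (b - a) * X1 := by positivity
    have hY3 : 0 ≤ (b - a)⁻¹ * X3 := by positivity
    have step : V ≤ c₂ ^ 2 * m⁻¹ * M * ((b - a) * X1)
        + (2 * c₂ ^ 2 + (1 + r) * CQ * m⁻¹) * s ^ 2 + (1 + r) * v a ^ 2 + (1 + r) * v b ^ 2
        + (1 + r) * M * m⁻¹ * ((b - a)⁻¹ * X3) := by
      rw [hVdef]
      unfold Vf Wf Ef
      rw [← hBdef]
      have rB := mul_le_mul_of_nonneg_left t3 hr.le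
      have rU := mul_le_mul_of_nonneg_left hU hr.le
      have rB0 := mul_nonneg hr.le hB0
      have ra := mul_nonneg hr.le (sq_nonneg (v a))
      have rb := mul_nonneg hr.le (sq_nonneg (v b))
      linarith
    set κ1 := c₂ ^ 2 * m⁻¹ * M
    set κ2 := 2 * c₂ ^ 2 + (1 + r) * CQ * m⁻¹
    set κ3 := (1 + r) * M * m⁻¹
    have z1 : 0 ≤ κ1 := by positivity
    have z2 : 0 ≤ κ2 := by positivity
    have z3 : 0 ≤ κ3 := by positivity
    have gen : ∀ κ : ℝ, κ ≤ κ1 + κ2 + (1 + r) + (1 + r) + κ3 → ∀ y : ℝ, 0 ≤ y →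
        κ * y ≤ (κ1 + κ2 + (1 + r) + (1 + r) + κ3) * y :=
      fun κ hκ y hy => mul_le_mul_of_nonneg_right hκ hy
    have g1 := gen κ1 (by linarith) _ hY1
    have g2 := gen κ2 (by linarith) _ (sq_nonneg s)
    have g3 := gen (1 + r) (by linarith) _ (sq_nonneg (v a))
    have g4 := gen (1 + r) (by linarith) _ (sq_nonneg (v b))
    have g5 := gen κ3 (by linarith) _ hY3
    simp only [mul_add (κ1 + κ2 + (1 + r) + (1 + r) + κ3)]
    linarith

/-- **Lemma 4 of the paper.**  Under Assumption (H), for every `S ≥ 0` there are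
constants `0 < G₁ ≤ G₂` such that for every static configuration `(a, b, ρ, v)` with
unit total mass and `V(a,b,ρ,v) ≤ S`, the Lyapunov functional is equivalent to the
state-norm quantity
`Ξ = (b−a)‖ρ_x‖₂² + ‖ρ − ρ*‖∞² + v²(a) + v²(b) + (b−a)⁻¹‖v‖₂²`:
`G₁ Ξ ≤ V(a,b,ρ,v) ≤ G₂ Ξ`. -/
theorem CLF_norm_equivalence
    (P μ P' : ℝ → ℝ) (Pext ρs : ℝ)
    (hP : ContDiffOn ℝ 2 P (Ioi 0)) (hμ : ContDiffOn ℝ 2 μ (Ioi 0))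
    (hPpos : ∀ x, 0 < x → 0 < P x) (hμpos : ∀ x, 0 < x → 0 < μ x)
    (hP' : ∀ x, 0 < x → HasDerivAt P (P' x) x)
    (hP'pos : ∀ x, 0 < x → 0 < P' x)
    (hPrange : P '' Ioi 0 = Ioi 0)
    (hPext : 0 < Pext) (hρs : 0 < ρs) (hPρs : P ρs = Pext)
    (hH : AssumpH P μ ρs)
    (r : ℝ) (hr : 0 < r) (S : ℝ) (hS : 0 ≤ S) :
    ∃ G₁ G₂ : ℝ, 0 < G₁ ∧ G₁ ≤ G₂ ∧
      ∀ (a b : ℝ) (ρ ρx v : ℝ → ℝ), a < b →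
        ContinuousOn ρ (Icc a b) → (∀ x ∈ Icc a b, 0 < ρ x) →
        H1On a b ρ ρx →
        ContinuousOn v (Icc a b) →
        (∫ x in a..b, ρ x) = 1 →
        Vf P μ ρs r a b ρ ρx v ≤ S →
        G₁ * ((b - a) * (∫ x in a..b, (ρx x) ^ 2)
              + (sSup ((fun x => |ρ x - ρs|) '' Icc a b)) ^ 2
              + (v a) ^ 2 + (v b) ^ 2 + (b - a)⁻¹ * (∫ x in a..b, (v x) ^ 2))
          ≤ Vf P μ ρs r a b ρ ρx v ∧
        Vf P μ ρs r a b ρ ρx v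
          ≤ G₂ * ((b - a) * (∫ x in a..b, (ρx x) ^ 2)
              + (sSup ((fun x => |ρ x - ρs|) '' Icc a b)) ^ 2
              + (v a) ^ 2 + (v b) ^ 2 + (b - a)⁻¹ * (∫ x in a..b, (v x) ^ 2)) := by
  have hPc := hP.continuousOn
  have hμc := hμ.continuousOn
  have hmono : StrictMonoOn P (Ioi 0) := by
    apply strictMonoOn_of_deriv_pos (convex_Ioi 0) hPc
    intro x hx
    rw [interior_Ioi] at hx
    rw [(hP' x hx).deriv]
    exact hP'pos x hx
  obtain ⟨m, M, hm, hρsm, hall⟩ := apriori hPc hmono hμc hμpos hρs hr hS hH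
  obtain ⟨CQ, hCQ, hQ⟩ := Qf_upper hP hm hρsm
  obtain ⟨c₁, c₂, hc₁, hc₂, hk⟩ := kf_bounds hμc hμpos hm hρsm
  have hmM : m ≤ M := hρsm.1.trans hρsm.2
  have hM : 0 < M := hm.trans_le hmM
  set K₁ := (m⁻¹ * M * c₁⁻¹ ^ 2 * (4 + 4 / r)) * 3 + 2 * c₁⁻¹ ^ 2 * (4 + 4 / r)
        + 2 / r + 2 / r + M * m⁻¹ * (2 / r) with hK₁
  set K₂ := c₂ ^ 2 * m⁻¹ * M + (2 * c₂ ^ 2 + (1 + r) * CQ * m⁻¹) + (1 + r) + (1 + r)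
        + (1 + r) * M * m⁻¹ with hK₂
  have hK₁0 : 0 < K₁ := by positivity
  have hK₂0 : 0 < K₂ := by positivity
  refine ⟨K₁⁻¹, K₁⁻¹ + K₂, by positivity, by linarith, ?_⟩
  intro a b ρ ρx v hab hρc hpos hH1 hv hmass hV
  obtain ⟨f1, f2⟩ := final_ineq hPc hmono hμc hρs hr hm hmM hc₁ hc₂ hCQ hQ hk hab hρc hpos hH1 hv
    hmass (hall a b ρ ρx v hab hρc hpos hH1 hv hmass hV)
  rw [← hK₁] at f1
  rw [← hK₂] at f2
  constructor
  · rw [inv_mul_le_iff₀ hK₁0]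
    exact f1
  · refine f2.trans (mul_le_mul_of_nonneg_right (by linarith [inv_pos.2 hK₁0]) ?_)
    have hX10 : 0 ≤ ∫ x in a..b, (ρx x) ^ 2 :=
      intervalIntegral.integral_nonneg hab.le (fun x _ => sq_nonneg _)
    have hX30 : 0 ≤ ∫ x in a..b, (v x) ^ 2 :=
      intervalIntegral.integral_nonneg hab.le (fun x _ => sq_nonneg _)
    have hL : 0 < b - a := by linarith
    positivity
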